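/- Suppose a < 0 and a + b < 0. Then, almost surely, lim_{t→∞} (X(t) − U(t)) = 0 and lim_{t→∞} (1/(1+t)) ( ∫_{−1}^0 ψ(u) du + ∫_0^t X(s) ds ) = 0. -/

import Mathlib

open MeasureTheory ProbabilityTheory Filter Real Set

noncomputable section

/-- `B` is a standard one-dimensional Brownian motion adapted to the filtration `F`
under the probability measure `P`: all paths are continuous and start at `0`, the
increment `B t - B s` is Gaussian with mean `0` and variance `t - s`, and increments
after time `s` are independent of `F s`. -/
def IsStdBrownian {Ω : Type*} {mΩ : MeasurableSpace Ω} (P : Measure Ω)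
    (F : MeasureTheory.Filtration ℝ mΩ) (B : ℝ → Ω → ℝ) : Prop :=
  MeasureTheory.Adapted F B ∧
  (∀ ω, B 0 ω = 0) ∧
  (∀ ω, Continuous fun t => B t ω) ∧
  (∀ s t : ℝ, 0 ≤ s → s ≤ t →
    P.map (fun ω => B t ω - B s ω) = gaussianReal 0 (Real.toNNReal (t - s))) ∧
  (∀ s t : ℝ, 0 ≤ s → s ≤ t →
    Indep (MeasurableSpace.comap (fun ω => B t ω - B s ω) Real.measurableSpace) (F s) P)

/-- `X` is the (continuous, adapted) solution of the affine stochastic functional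
differential equation `dX(t) = (a X(t) + b/(1+t) ∫_{-1}^t X(s) ds) dt + σ dB(t)` for
`t ≥ 0`, with initial history `ψ` on `[-1, 0]`; i.e. almost surely, for all `t ≥ 0`,
`X t = ψ 0 + ∫_0^t (a X(s) + b/(1+s) (∫_{-1}^0 ψ(u) du + ∫_0^s X(u) du)) ds + σ B t`. -/
def IsSolutionSFDE {Ω : Type*} {mΩ : MeasurableSpace Ω} (P : Measure Ω)
    (F : MeasureTheory.Filtration ℝ mΩ) (a b σ : ℝ) (ψ : ℝ → ℝ)
    (B X : ℝ → Ω → ℝ) : Prop :=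
  (∀ t : ℝ, 0 ≤ t → StronglyMeasurable[F t] (X t)) ∧
  (∀ ω, ContinuousOn (fun t => X t ω) (Set.Ici (0 : ℝ))) ∧
  (∀ᵐ ω ∂P, ∀ t : ℝ, 0 ≤ t →
    X t ω = ψ 0
      + (∫ s in (0:ℝ)..t,
          (a * X s ω + b / (1 + s) * ((∫ u in (-1:ℝ)..(0:ℝ), ψ u) + ∫ u in (0:ℝ)..s, X u ω)))
      + σ * B t ω)

/-- `U` is the Ornstein–Uhlenbeck process driven by `σ B` with `U 0 = 0`: the
(continuous, adapted) process with, almost surely, `U t = a ∫_0^t U(s) ds + σ B t`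
for all `t ≥ 0`. -/
def IsOUProcess {Ω : Type*} {mΩ : MeasurableSpace Ω} (P : Measure Ω)
    (F : MeasureTheory.Filtration ℝ mΩ) (a σ : ℝ) (B U : ℝ → Ω → ℝ) : Prop :=
  (∀ t : ℝ, 0 ≤ t → StronglyMeasurable[F t] (U t)) ∧
  (∀ ω, ContinuousOn (fun t => U t ω) (Set.Ici (0 : ℝ))) ∧
  (∀ᵐ ω ∂P, ∀ t : ℝ, 0 ≤ t →
    U t ω = a * (∫ s in (0:ℝ)..t, U s ω) + σ * B t ω)

theorem hasDerivAt_integral_of_continuousOn_Ici {f : ℝ → ℝ} (hf : ContinuousOn f (Ici 0))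
    {t : ℝ} (ht : 0 < t) : HasDerivAt (fun t => ∫ s in (0:ℝ)..t, f s) (f t) t := by
  have hnhds : Ici (0:ℝ) ∈ nhds t := Ici_mem_nhds ht
  refine intervalIntegral.integral_hasDerivAt_right ?_ ?_ (hf.continuousAt hnhds)
  · refine (hf.mono ?_).intervalIntegrable
    rw [uIcc_of_le ht.le]
    exact Icc_subset_Ici_self
  · exact (hf.mono Ioi_subset_Ici_self).stronglyMeasurableAtFilter isOpen_Ioi t ht

/-- A comparison principle: if `f` is nonnegative with `f' ≤ p (-c f + g)`, where `p ≥ 0` has a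
primitive tending to infinity and `g` tends to zero, then `f` tends to zero. -/
theorem tendsto_zero_of_deriv_le {f f' G p g : ℝ → ℝ} {c : ℝ} (hc : 0 < c)
    (hf : ∀ᶠ t in atTop, HasDerivAt f (f' t) t) (hG : ∀ᶠ t in atTop, HasDerivAt G (p t) t)
    (hp : ∀ᶠ t in atTop, 0 ≤ p t) (hGt : Tendsto G atTop atTop)
    (hg : Tendsto g atTop (nhds 0)) (hle : ∀ᶠ t in atTop, f' t ≤ p t * (-c * f t + g t))
    (hf0 : ∀ᶠ t in atTop, 0 ≤ f t) : Tendsto f atTop (nhds 0) := by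
  refine tendsto_order.2 ⟨fun y hy => hf0.mono fun t ht => hy.trans_le ht, fun ε hε => ?_⟩
  have hg' : ∀ᶠ t in atTop, g t < c * (ε / 2) := hg.eventually_lt_const (by positivity)
  obtain ⟨T, hT⟩ := eventually_atTop.1 (hf.and (hG.and (hp.and (hle.and hg'))))
  have hanti : AntitoneOn (fun t => (f t - ε / 2) * exp (c * G t)) (Ici T) := by
    have hd : ∀ t ∈ Ici T, HasDerivAt (fun t => (f t - ε / 2) * exp (c * G t))
        (f' t * exp (c * G t) + (f t - ε / 2) * (exp (c * G t) * (c * p t))) t := by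
      intro t ht
      obtain ⟨h1, h2, -⟩ := hT t ht
      exact (h1.sub_const _).mul ((h2.const_mul c).exp)
    refine antitoneOn_of_hasDerivWithinAt_nonpos (convex_Ici T)
      (fun t ht => (hd t ht).continuousAt.continuousWithinAt)
      (fun t ht => (hd t (interior_subset ht)).hasDerivWithinAt) fun t ht => ?_
    obtain ⟨-, -, h3, h4, h5⟩ := hT t (interior_subset ht)
    have : f' t + (f t - ε / 2) * (c * p t) ≤ 0 := by
      have := mul_le_mul_of_nonneg_left h5.le h3
      nlinarith
    have := mul_nonpos_of_nonpos_of_nonneg this (exp_pos (c * G t)).le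
    linarith
  have hlim : Tendsto (fun t => |(f T - ε / 2) * exp (c * G T)| * exp (-(c * G t))) atTop
      (nhds 0) := by
    have := (tendsto_exp_neg_atTop_nhds_zero.comp (hGt.const_mul_atTop hc)).const_mul
      |(f T - ε / 2) * exp (c * G T)|
    simpa using this
  filter_upwards [hlim.eventually_lt_const (half_pos hε), eventually_ge_atTop T] with t h1 h2
  have h3 := (hanti self_mem_Ici h2 h2).trans (le_abs_self _)
  have h4 := mul_le_mul_of_nonneg_right h3 (exp_pos (-(c * G t))).le
  have h5 : exp (c * G t) * exp (-(c * G t)) = 1 := by rw [← Real.exp_add, add_neg_cancel, exp_zero]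
  rw [mul_assoc, h5, mul_one] at h4
  linarith

theorem tendsto_zero_of_tendsto_pow_zero {f : ℝ → ℝ} {n : ℕ} (hn : n ≠ 0)
    (h : Tendsto (fun t => f t ^ n) atTop (nhds 0)) : Tendsto f atTop (nhds 0) := by
  rw [tendsto_zero_iff_abs_tendsto_zero] at h ⊢
  have h2 := h.rpow_const (p := (1 / n : ℝ)) (Or.inr (by positivity))
  rw [Real.zero_rpow (by positivity)] at h2
  refine h2.congr fun t => ?_
  simp only [Function.comp_apply]
  rw [abs_pow, one_div, Real.pow_rpow_inv_natCast (abs_nonneg _) hn]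

/-- Exponential decay driven by an integrable nonnegative forcing term gives convergence to zero. -/
theorem tendsto_zero_of_deriv_le_of_integrableOn {f f' q : ℝ → ℝ} {c : ℝ} (hc : 0 < c)
    (hf : ∀ t, 0 < t → HasDerivAt f (f' t) t) (hq : ContinuousOn q (Ici 0))
    (hqi : IntegrableOn q (Ioi 1)) (hq0 : ∀ t, 0 ≤ q t)
    (hle : ∀ t, 0 < t → f' t ≤ -c * f t + q t) (hf0 : ∀ t, 0 ≤ f t) :
    Tendsto f atTop (nhds 0) := by
  set H : ℝ → ℝ := fun t => (∫ s in Ioi (1:ℝ), q s) + (∫ s in (0:ℝ)..1, q s)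
    - ∫ s in (0:ℝ)..t, q s with hH
  have hint : ∀ s t : ℝ, 0 ≤ s → 0 ≤ t → IntervalIntegrable q volume s t := fun s t hs ht =>
    (hq.mono fun x hx => (le_min hs ht).trans hx.1).intervalIntegrable
  have hHd : ∀ t, 0 < t → HasDerivAt H (-q t) t := fun t ht =>
    (hasDerivAt_integral_of_continuousOn_Ici hq ht).const_sub _
  have hH1 : ∀ t, 0 ≤ t → H t = (∫ s in Ioi (1:ℝ), q s) - ∫ s in (1:ℝ)..t, q s := by
    intro t ht
    simp only [hH]
    rw [← intervalIntegral.integral_add_adjacent_intervals (hint 0 1 le_rfl zero_le_one)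
      (hint 1 t zero_le_one ht)]
    ring
  have hHt : Tendsto H atTop (nhds 0) := by
    have h := (intervalIntegral_tendsto_integral_Ioi 1 hqi tendsto_id).const_sub
      (∫ s in Ioi (1:ℝ), q s)
    rw [sub_self] at h
    refine h.congr' ?_
    filter_upwards [eventually_ge_atTop 0] with t ht using (hH1 t ht).symm
  have hH0 : ∀ t, 1 ≤ t → 0 ≤ H t := by
    intro t ht
    rw [hH1 t (by linarith), intervalIntegral.integral_of_le ht, sub_nonneg]
    exact setIntegral_mono_set hqi (ae_of_all _ hq0) Ioc_subset_Ioi_self.eventuallyLE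
  have hsum : Tendsto (fun t => f t + H t) atTop (nhds 0) := by
    refine tendsto_zero_of_deriv_le (G := id) (p := fun _ => 1) (g := fun t => c * H t) hc
      (f' := fun t => f' t + -q t) ?_ (Eventually.of_forall fun t => hasDerivAt_id t)
      (Eventually.of_forall fun _ => zero_le_one) tendsto_id (by simpa using hHt.const_mul c) ?_ ?_
    · filter_upwards [eventually_gt_atTop 0] with t ht using (hf t ht).add (hHd t ht)
    · filter_upwards [eventually_gt_atTop 0] with t ht
      linarith [hle t ht]
    · filter_upwards [eventually_ge_atTop 1] with t ht using add_nonneg (hf0 t) (hH0 t ht)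
  simpa using hsum.sub hHt

theorem tendsto_one_div_one_add_atTop : Tendsto (fun t : ℝ => 1 / (1 + t)) atTop (nhds 0) := by
  simp only [one_div]
  exact (tendsto_atTop_add_const_left atTop (1:ℝ) tendsto_id).inv_tendsto_atTop

/-- The time average of an Ornstein–Uhlenbeck path tends to zero once the driving path `w` is
such that `(w t / (1 + t)) ^ 4` is integrable. -/
theorem tendsto_average_ornsteinUhlenbeck {a : ℝ} (ha : a < 0) {u w : ℝ → ℝ}
    (hu : ContinuousOn u (Ici 0)) (hw : ContinuousOn w (Ici 0))
    (hwi : IntegrableOn (fun t => (w t / (1 + t)) ^ 4) (Ioi 1))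
    (hueq : ∀ t, 0 ≤ t → u t = a * (∫ s in (0:ℝ)..t, u s) + w t) :
    Tendsto (fun t => (∫ s in (0:ℝ)..t, u s) / (1 + t)) atTop (nhds 0) := by
  refine tendsto_zero_of_tendsto_pow_zero (n := 4) (by norm_num) ?_
  refine tendsto_zero_of_deriv_le_of_integrableOn (c := -a) (neg_pos.2 ha)
    (q := fun t => (-a) * ((w t / (1 + t)) ^ 4 * (1 / a) ^ 4))
    (fun t ht => (((hasDerivAt_integral_of_continuousOn_Ici hu ht).div
      ((hasDerivAt_id t).const_add 1) (by simp; linarith)).pow 4)) ?_ ?_ ?_ ?_ ?_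
  · refine continuousOn_const.mul (((hw.div (by fun_prop) ?_).pow 4).mul continuousOn_const)
    intro t ht
    have : (0:ℝ) ≤ t := ht
    positivity
  · exact (hwi.mul_const _).const_mul _
  · intro t
    have : 0 ≤ -a := by linarith
    positivity
  · intro t ht
    have h1 : 0 < 1 + t := by linarith
    simp only [id, Pi.div_apply]
    rw [hueq t ht.le]
    set R := ∫ s in (0:ℝ)..t, u s
    obtain ⟨r, hr⟩ : ∃ r, r = R / (1 + t) := ⟨_, rfl⟩
    obtain ⟨k, hk⟩ : ∃ k, k = w t / (1 + t) * (1 / a) := ⟨_, rfl⟩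
    rw [← mul_pow, ← hk, ← hr]
    have hd : ((a * R + w t) * (1 + t) - R * 1) / (1 + t) ^ 2 = a * (r + k) - r / (1 + t) := by
      rw [hr, hk]
      have := ha.ne
      field_simp
    have hq : 0 ≤ r ^ 4 / (1 + t) := by positivity
    have hk4 : 4 * (r ^ 3 * -k) ≤ 3 * r ^ 4 + k ^ 4 := by
      have := mul_nonneg (sq_nonneg (r + k)) (add_nonneg (sq_nonneg (r - k)) (mul_nonneg zero_le_two (sq_nonneg r)))
      nlinarith
    have hk5 := mul_le_mul_of_nonneg_left hk4 (neg_pos.2 ha).le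
    push_cast
    rw [mul_one] at hd ⊢
    rw [hd]
    have : r ^ 3 * (r / (1 + t)) = r ^ 4 / (1 + t) := by ring
    nlinarith
  · intro t
    positivity

theorem two_mul_mul_le_add_div {e : ℝ} (he : 0 < e) (x y : ℝ) :
    2 * x * y ≤ e * x ^ 2 + y ^ 2 / e := by
  have h : 0 ≤ (e * x - y) ^ 2 / e := by positivity
  have h2 : (e * x - y) ^ 2 / e = e * x ^ 2 - 2 * x * y + y ^ 2 / e := by
    field_simp
    ring
  linarith

/-- Dissipation inequality for the quadratic Lyapunov function `Q ^ 2 + δ * Z ^ 2 * u`. -/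
theorem lyapunov_dissipation {α β κ δ u Q Z A : ℝ} (hα : 0 < α) (hκ : κ = 1 + β) (hκ0 : 0 < κ)
    (hδ : 0 < δ) (hδ' : δ * (2 * α * β ^ 2) ≤ κ / 4) (hu0 : 0 ≤ u) (hu1 : u ≤ 1)
    (hu : 4 * β ^ 2 / (α ^ 2 * κ) * u ^ 2 + 2 * δ * |β| * u ≤ δ * α / 2) :
    2 * Q * (-Q - β * (Q - Z * u / α + A))
        + δ * (2 * Z * (-α * Z - α * β * (Q - Z * u / α) - α * β * A) - Z ^ 2 * u)
      ≤ -(min κ (α / 2)) * (Q ^ 2 + δ * (Z ^ 2 * u))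
        + (2 * β ^ 2 / κ + δ * (2 * α * β ^ 2)) * A ^ 2 := by
  have p1 := two_mul_mul_le_add_div (half_pos hκ0) Q (-β * A)
  have p2 := two_mul_mul_le_add_div (e := κ / 4) (by positivity) Q (β * Z * u / α)
  have p3 := mul_le_mul_of_nonneg_left
    (two_mul_mul_le_add_div (half_pos hα) Z (-α * β * Q)) hδ.le
  have p5 := mul_le_mul_of_nonneg_left
    (two_mul_mul_le_add_div (half_pos hα) Z (-α * β * A)) hδ.le
  have p4 : δ * (2 * β * u * Z ^ 2) ≤ 2 * δ * |β| * u * Z ^ 2 := by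
    have := mul_le_mul_of_nonneg_right (le_abs_self β)
      (show 0 ≤ 2 * δ * u * Z ^ 2 by positivity)
    linarith
  have p6 := mul_le_mul_of_nonneg_right hδ' (sq_nonneg Q)
  have p7 := mul_le_mul_of_nonneg_right hu (sq_nonneg Z)
  have m1 := mul_le_mul_of_nonneg_right (min_le_left κ (α / 2)) (sq_nonneg Q)
  have m2 : min κ (α / 2) * (δ * (Z ^ 2 * u)) ≤ α / 2 * (δ * Z ^ 2) := by
    have h : Z ^ 2 * u ≤ Z ^ 2 := mul_le_of_le_one_right (sq_nonneg Z) hu1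
    have := min_le_right κ (α / 2)
    gcongr
  have e1 : (-β * A) ^ 2 / (κ / 2) = 2 * β ^ 2 / κ * A ^ 2 := by field_simp
  have e2 : (β * Z * u / α) ^ 2 / (κ / 4) = 4 * β ^ 2 / (α ^ 2 * κ) * u ^ 2 * Z ^ 2 := by
    field_simp
  have e3 : (-α * β * Q) ^ 2 / (α / 2) = 2 * α * β ^ 2 * Q ^ 2 := by field_simp
  have e5 : (-α * β * A) ^ 2 / (α / 2) = 2 * α * β ^ 2 * A ^ 2 := by field_simp
  have e4 : 2 * Z * (α * β * (Z * u / α)) = 2 * β * u * Z ^ 2 := by field_simp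
  have e6 : 2 * Q * (β * (Z * u / α)) = 2 * Q * (β * Z * u / α) := by ring
  have hZu : 0 ≤ δ * (Z ^ 2 * u) := by positivity
  rw [e1] at p1
  rw [e2] at p2
  rw [e3] at p3
  rw [e5] at p5
  subst hκ
  have expand : 2 * Q * (-Q - β * (Q - Z * u / α + A))
        + δ * (2 * Z * (-α * Z - α * β * (Q - Z * u / α) - α * β * A) - Z ^ 2 * u)
      = -2 * (1 + β) * Q ^ 2 + 2 * Q * (β * (Z * u / α)) + 2 * Q * (-β * A)
        - 2 * α * δ * Z ^ 2 + δ * (2 * Z * (-α * β * Q)) + δ * (2 * Z * (α * β * (Z * u / α)))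
        + δ * (2 * Z * (-α * β * A)) - δ * (Z ^ 2 * u) := by ring
  rw [expand, e4, e6]
  linarith

/-- Stability of `z' = a z + b j / (1 + t) + b A`, `j' = z` under a vanishing perturbation `A`. -/
theorem tendsto_zero_of_linear_averaged_system {a b : ℝ} (ha : a < 0) (hab : a + b < 0)
    {z j A : ℝ → ℝ} (hj : ∀ t, 0 < t → HasDerivAt j (z t) t)
    (hz : ∀ t, 0 < t → HasDerivAt z (a * z t + b * (j t / (1 + t) + A t)) t)
    (hA : Tendsto A atTop (nhds 0)) :
    Tendsto z atTop (nhds 0) ∧ Tendsto (fun t => j t / (1 + t)) atTop (nhds 0) := by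
  obtain ⟨α, hα⟩ : ∃ α, α = -a := ⟨_, rfl⟩
  obtain ⟨β, hβ⟩ : ∃ β, β = b / a := ⟨_, rfl⟩
  obtain ⟨κ, hκ⟩ : ∃ κ, κ = 1 + β := ⟨_, rfl⟩
  have hα0 : 0 < α := by linarith
  have hb : b = -α * β := by
    rw [hα, hβ]
    field_simp [ha.ne]
  have haα : a = -α := by linarith
  have hκ0 : 0 < κ := by
    have : κ = (a + b) / a := by
      rw [hκ, hβ]
      field_simp [ha.ne]
    rw [this]
    exact div_pos_of_neg_of_neg hab ha
  obtain ⟨δ, hδ⟩ : ∃ δ, δ = κ / (4 * (2 * α * β ^ 2 + 1)) := ⟨_, rfl⟩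
  have hδ0 : 0 < δ := by
    rw [hδ]
    positivity
  have hδ' : δ * (2 * α * β ^ 2) ≤ κ / 4 := by
    rw [hδ, div_mul_eq_mul_div, div_le_div_iff₀ (by positivity) (by norm_num)]
    nlinarith
  set u : ℝ → ℝ := fun t => 1 / (1 + t) with hu
  have hut : Tendsto u atTop (nhds 0) := tendsto_one_div_one_add_atTop
  have hu' : ∀ t, 0 < t → HasDerivAt u (-(u t) ^ 2) t := by
    intro t ht
    have h := (hasDerivAt_const t (1:ℝ)).div ((hasDerivAt_id t).const_add 1)
      (by simp; linarith)
    refine h.congr_deriv ?_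
    simp [hu, neg_div]
  have hQ : Tendsto (fun t => (j t * u t + z t * u t / α) ^ 2 + δ * (z t ^ 2 * u t)) atTop
      (nhds 0) := by
    refine tendsto_zero_of_deriv_le (c := min κ (α / 2)) (lt_min hκ0 (half_pos hα0))
      (f' := fun t => 2 * (j t * u t + z t * u t / α)
        * (z t * u t + j t * (-(u t) ^ 2)
          + ((a * z t + b * (j t / (1 + t) + A t)) * u t + z t * (-(u t) ^ 2)) / α)
        + δ * (2 * z t * (a * z t + b * (j t / (1 + t) + A t)) * u t + z t ^ 2 * (-(u t) ^ 2)))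
      (G := fun t => Real.log (1 + t)) (p := u)
      (g := fun t => (2 * β ^ 2 / κ + δ * (2 * α * β ^ 2)) * A t ^ 2) ?_ ?_ ?_ ?_ ?_ ?_ ?_
    · filter_upwards [eventually_gt_atTop 0] with t ht
      have h1 := ((((hj t ht).mul (hu' t ht)).add (((hz t ht).mul (hu' t ht)).div_const α)).pow 2)
      have h2 := ((((hz t ht).pow 2).mul (hu' t ht)).const_mul δ)
      convert! h1.add h2 using 1
      simp
    · filter_upwards [eventually_gt_atTop 0] with t ht
      have h := ((hasDerivAt_id t).const_add 1).log (by simp; linarith)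
      simpa [hu] using h
    · filter_upwards [eventually_gt_atTop 0] with t ht
      simp only [hu]
      positivity
    · exact tendsto_log_atTop.comp (tendsto_atTop_add_const_left atTop (1:ℝ) tendsto_id)
    · simpa using (hA.pow 2).const_mul (2 * β ^ 2 / κ + δ * (2 * α * β ^ 2))
    · have hsmall : Tendsto (fun t => 4 * β ^ 2 / (α ^ 2 * κ) * u t ^ 2 + 2 * δ * |β| * u t) atTop
          (nhds 0) := by
        simpa using ((hut.pow 2).const_mul (4 * β ^ 2 / (α ^ 2 * κ))).add
          (hut.const_mul (2 * δ * |β|))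
      filter_upwards [eventually_gt_atTop 0,
        hsmall.eventually_le_const (show 0 < δ * α / 2 by positivity)] with t ht hsm
      have hu0 : 0 ≤ u t := by
        simp only [hu]
        positivity
      have hu1 : u t ≤ 1 := by
        simp only [hu]
        rw [div_le_one (by positivity)]
        linarith
      have hdis := mul_le_mul_of_nonneg_left (lyapunov_dissipation (A := A t) (Z := z t)
        (Q := j t * u t + z t * u t / α) hα0 hκ hκ0 hδ0 hδ' hu0 hu1 hsm) hu0
      refine le_trans (le_of_eq ?_) hdis
      have hjt : j t / (1 + t) = j t * u t := by simp [hu, div_eq_mul_inv]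
      rw [hjt, hb, haα]
      field_simp
      ring
    · filter_upwards [eventually_gt_atTop 0] with t ht
      have : 0 ≤ u t := by
        simp only [hu]
        positivity
      positivity
  have hu0 : ∀ᶠ t in atTop, 0 ≤ u t ∧ u t ≤ 1 := by
    filter_upwards [eventually_gt_atTop 0] with t ht
    simp only [hu]
    refine ⟨by positivity, ?_⟩
    rw [div_le_one (by positivity)]
    linarith
  have hQ1 : Tendsto (fun t => j t * u t + z t * u t / α) atTop (nhds 0) := by
    refine tendsto_zero_of_tendsto_pow_zero two_ne_zero
      (squeeze_zero' (Eventually.of_forall fun t => sq_nonneg _) ?_ hQ)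
    filter_upwards [hu0] with t ht
    have := ht.1
    exact le_add_of_nonneg_right (by positivity)
  have hzu : Tendsto (fun t => z t * u t) atTop (nhds 0) := by
    refine tendsto_zero_of_tendsto_pow_zero two_ne_zero
      (squeeze_zero' (Eventually.of_forall fun t => sq_nonneg _) ?_
        (by simpa using hQ.const_mul (1 / δ)))
    filter_upwards [hu0] with t ht
    have h1 : (z t * u t) ^ 2 ≤ z t ^ 2 * u t := by
      have := mul_le_of_le_one_right (mul_nonneg (sq_nonneg (z t)) ht.1) ht.2
      linarith
    refine h1.trans ?_
    rw [← div_eq_inv_mul, le_div_iff₀ hδ0]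
    nlinarith [sq_nonneg (j t * u t + z t * u t / α)]
  have hW : Tendsto (fun t => j t / (1 + t)) atTop (nhds 0) := by
    have := hQ1.sub (hzu.div_const α)
    simp only [zero_div, sub_zero] at this
    refine this.congr fun t => ?_
    simp [hu, div_eq_mul_inv]
  refine ⟨tendsto_zero_of_tendsto_pow_zero two_ne_zero ?_, hW⟩
  refine tendsto_zero_of_deriv_le (c := α) hα0 (G := id) (p := fun _ => 1)
    (f' := fun t => 2 * z t * (a * z t + b * (j t / (1 + t) + A t)))
    (g := fun t => (b * (j t / (1 + t) + A t)) ^ 2 / α) ?_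
    (Eventually.of_forall fun t => hasDerivAt_id t)
    (Eventually.of_forall fun _ => zero_le_one) tendsto_id
    (by simpa using (((hW.add hA).const_mul b).pow 2).div_const α) ?_
    (Eventually.of_forall fun t => sq_nonneg _)
  · filter_upwards [eventually_gt_atTop 0] with t ht
    refine ((hz t ht).pow 2).congr_deriv ?_
    simp
  · refine Eventually.of_forall fun t => ?_
    have := two_mul_mul_le_add_div hα0 (z t) (b * (j t / (1 + t) + A t))
    simp only [one_mul]
    rw [haα] at *
    linarith

/-- Pathwise form of the theorem, for driving paths `w` with `(w t / (1 + t)) ^ 4` integrable. -/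
theorem tendsto_sub_ornsteinUhlenbeck_of_integrableOn {a b c x₀ : ℝ} (ha : a < 0)
    (hab : a + b < 0) {x u w : ℝ → ℝ} (hx : ContinuousOn x (Ici 0)) (hu : ContinuousOn u (Ici 0))
    (hw : ContinuousOn w (Ici 0)) (hwi : IntegrableOn (fun t => (w t / (1 + t)) ^ 4) (Ioi 1))
    (hxeq : ∀ t, 0 ≤ t → x t = x₀
      + (∫ s in (0:ℝ)..t, (a * x s + b / (1 + s) * (c + ∫ r in (0:ℝ)..s, x r))) + w t)
    (hueq : ∀ t, 0 ≤ t → u t = a * (∫ s in (0:ℝ)..t, u s) + w t) :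
    Tendsto (fun t => x t - u t) atTop (nhds 0) ∧
      Tendsto (fun t => (1 / (1 + t)) * (c + ∫ s in (0:ℝ)..t, x s)) atTop (nhds 0) := by
  have hA := tendsto_average_ornsteinUhlenbeck ha hu hw hwi hueq
  have hprim : ContinuousOn (fun s => ∫ r in (0:ℝ)..s, x r) (Ici 0) := by
    intro s hs
    have hs0 : (0:ℝ) ≤ s := hs
    have hint : IntervalIntegrable x volume 0 (s + 1) :=
      (hx.mono fun y hy => (le_min le_rfl (by linarith)).trans hy.1).intervalIntegrable
    have h := intervalIntegral.continuousOn_primitive_interval' hint left_mem_uIcc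
    rw [uIcc_of_le (by linarith)] at h
    refine (h s ⟨hs0, by linarith⟩).mono_of_mem_nhdsWithin ?_
    rw [← Ici_inter_Iic]
    exact inter_mem self_mem_nhdsWithin (mem_nhdsWithin_of_mem_nhds (Iic_mem_nhds (by linarith)))
  have hdrift : ContinuousOn
      (fun s => a * x s + b / (1 + s) * (c + ∫ r in (0:ℝ)..s, x r)) (Ici 0) := by
    refine (continuousOn_const.mul hx).add
      ((continuousOn_const.div (by fun_prop) fun s hs => ?_).mul (continuousOn_const.add hprim))
    have : (0:ℝ) ≤ s := hs
    positivity
  have key := tendsto_zero_of_linear_averaged_system ha hab (z := fun t => x t - u t)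
    (j := fun t => c + (∫ s in (0:ℝ)..t, x s) - ∫ s in (0:ℝ)..t, u s)
    (A := fun t => (∫ s in (0:ℝ)..t, u s) / (1 + t))
    (fun t ht => ((hasDerivAt_integral_of_continuousOn_Ici hx ht).const_add c).sub
      (hasDerivAt_integral_of_continuousOn_Ici hu ht)) ?_ hA
  · refine ⟨key.1, ?_⟩
    have h := key.2.add hA
    rw [add_zero] at h
    refine h.congr fun t => ?_
    ring
  · intro t ht
    have h := ((hasDerivAt_integral_of_continuousOn_Ici hdrift ht).const_add x₀).sub
      ((hasDerivAt_integral_of_continuousOn_Ici hu ht).const_mul a)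
    refine (h.congr_of_eventuallyEq ?_).congr_deriv ?_
    · filter_upwards [Ioi_mem_nhds ht] with s hs
      rw [hxeq s (le_of_lt hs), hueq s (le_of_lt hs)]
      simp
    · have : 0 < 1 + t := by linarith
      field_simp
      ring

/-- Brownian paths grow slowly enough that `(B t / (1 + t)) ^ 4` is almost surely integrable. -/
theorem IsStdBrownian.ae_integrableOn_div_pow_four {Ω : Type*} {mΩ : MeasurableSpace Ω}
    {P : Measure Ω} [IsProbabilityMeasure P] {F : MeasureTheory.Filtration ℝ mΩ}
    {B : ℝ → Ω → ℝ} (hB : IsStdBrownian P F B) :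
    ∀ᵐ ω ∂P, IntegrableOn (fun t => (B t ω / (1 + t)) ^ 4) (Ioi 1) := by
  obtain ⟨hadapt, h0, hcont, hlaw, -⟩ := hB
  have hmeas : ∀ t, Measurable (B t) := fun t => (hadapt t).mono (F.le t) le_rfl
  have hjoint : Measurable (Function.uncurry B) :=
    measurable_uncurry_of_continuous_of_measurable hcont hmeas
  set C : ENNReal := ∫⁻ x, ENNReal.ofReal (x ^ 4) ∂(gaussianReal 0 1) with hC
  have hCtop : C ≠ ⊤ := by
    have h := (memLp_id_gaussianReal' (μ := 0) (v := 1) 4 (by norm_num)).integrable_norm_pow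
      (by norm_num)
    have h4 : Integrable (fun x : ℝ => x ^ 4) (gaussianReal 0 1) := by
      refine h.congr (ae_of_all _ fun x => ?_)
      simp [Even.pow_abs (show Even 4 by decide)]
    exact ((hasFiniteIntegral_iff_ofReal (ae_of_all _ fun x => by positivity)).1 h4.2).ne
  have hmoment : ∀ t, 0 ≤ t →
      ∫⁻ ω, ENNReal.ofReal (B t ω ^ 4) ∂P = ENNReal.ofReal (t ^ 2) * C := by
    intro t ht
    have hl : P.map (B t) = (gaussianReal 0 1).map (√t * ·) := by
      have h := hlaw 0 t le_rfl ht
      simp only [h0, sub_zero] at h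
      rw [gaussianReal_map_const_mul, show B t = fun ω => B t ω from rfl, h]
      congr 1
      · simp
      · ext
        simp [ht]
    rw [← lintegral_map (f := fun x : ℝ => ENNReal.ofReal (x ^ 4)) (by fun_prop) (hmeas t), hl,
      lintegral_map (by fun_prop) (by fun_prop), hC, ← lintegral_const_mul _ (by fun_prop)]
    refine lintegral_congr fun x => ?_
    rw [← ENNReal.ofReal_mul (by positivity), mul_pow]
    congr 2
    rw [show 4 = 2 * 2 from rfl, pow_mul, Real.sq_sqrt ht]
  have hm : Measurable (Function.uncurry fun (ω : Ω) (t : ℝ) =>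
      ENNReal.ofReal ((B t ω / (1 + t)) ^ 4)) := by
    have h1 : Measurable fun z : Ω × ℝ => B z.2 z.1 := hjoint.comp measurable_swap
    exact ((h1.div (measurable_snd.const_add 1)).pow_const 4).ennreal_ofReal
  have hfin : ∫⁻ ω, ∫⁻ t in Ioi (1:ℝ), ENNReal.ofReal ((B t ω / (1 + t)) ^ 4) ∂volume ∂P ≠ ⊤ := by
    rw [lintegral_lintegral_swap hm.aemeasurable]
    have hle : ∀ t ∈ Ioi (1:ℝ), ∫⁻ ω, ENNReal.ofReal ((B t ω / (1 + t)) ^ 4) ∂P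
        ≤ C * ENNReal.ofReal (t ^ (-2:ℝ)) := by
      intro t ht
      have ht0 : (0:ℝ) < t := zero_lt_one.trans ht
      calc ∫⁻ ω, ENNReal.ofReal ((B t ω / (1 + t)) ^ 4) ∂P
          = ∫⁻ ω, ENNReal.ofReal (1 / (1 + t) ^ 4) * ENNReal.ofReal (B t ω ^ 4) ∂P := by
            refine lintegral_congr fun ω => ?_
            rw [← ENNReal.ofReal_mul (by positivity)]
            rw [div_pow, one_div, div_eq_inv_mul]
        _ = C * ENNReal.ofReal (1 / (1 + t) ^ 4 * t ^ 2) := by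
            rw [lintegral_const_mul _ ((hmeas t).pow_const 4).ennreal_ofReal, hmoment t ht0.le,
              ← mul_assoc, ← ENNReal.ofReal_mul (by positivity), mul_comm]
        _ ≤ C * ENNReal.ofReal (t ^ (-2:ℝ)) := by
            gcongr
            rw [Real.rpow_neg ht0.le, Real.rpow_two, one_div, ← div_eq_inv_mul, ← one_div,
              div_le_div_iff₀ (by positivity) (by positivity)]
            calc t ^ 2 * t ^ 2 = t ^ 4 := by ring
              _ ≤ (1 + t) ^ 4 := by gcongr; linarith
              _ = 1 * (1 + t) ^ 4 := (one_mul _).symm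
    refine ne_top_of_le_ne_top ?_ (setLIntegral_mono' measurableSet_Ioi hle)
    rw [lintegral_const_mul _ (by fun_prop)]
    refine ENNReal.mul_ne_top hCtop ?_
    have h := integrableOn_Ioi_rpow_of_lt (a := -2) (c := 1) (by norm_num) one_pos
    refine ((hasFiniteIntegral_iff_ofReal ?_).1 h.2).ne
    filter_upwards [ae_restrict_mem measurableSet_Ioi] with t ht
    exact Real.rpow_nonneg (zero_le_one.trans (le_of_lt ht)) _
  filter_upwards [ae_lt_top hm.lintegral_prod_right' hfin] with ω hω
  refine ⟨(((hcont ω).measurable.div (measurable_id.const_add 1)).pow_const 4).aestronglyMeasurable,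
    (hasFiniteIntegral_iff_ofReal (ae_of_all _ fun t => ?_)).2 hω⟩
  exact Even.pow_nonneg (by decide) _

theorem sfde_asymptotically_OU {Ω : Type*} {mΩ : MeasurableSpace Ω} (P : Measure Ω) [IsProbabilityMeasure P]
    (F : MeasureTheory.Filtration ℝ mΩ) (a b σ : ℝ) (ψ : ℝ → ℝ) (B X : ℝ → Ω → ℝ)
    (hσ : 0 < σ) (hψ : ContinuousOn ψ (Set.Icc (-1 : ℝ) 0))
    (hB : IsStdBrownian P F B) (hX : IsSolutionSFDE P F a b σ ψ B X)
    (U : ℝ → Ω → ℝ) (hU : IsOUProcess P F a σ B U)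
    (ha : a < 0) (hab : a + b < 0) :
    ∀ᵐ ω ∂P,
      Filter.Tendsto (fun t : ℝ => X t ω - U t ω) Filter.atTop (nhds 0) ∧
      Filter.Tendsto
        (fun t : ℝ => (1 / (1 + t)) * ((∫ u in (-1:ℝ)..(0:ℝ), ψ u) + ∫ s in (0:ℝ)..t, X s ω))
        Filter.atTop (nhds 0) := by
  have hint := hB.ae_integrableOn_div_pow_four
  obtain ⟨-, -, hBc, -⟩ := hB
  obtain ⟨-, hXc, hXeq⟩ := hX
  obtain ⟨-, hUc, hUeq⟩ := hU
  filter_upwards [hint, hXeq, hUeq] with ω hω hXω hUω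
  refine tendsto_sub_ornsteinUhlenbeck_of_integrableOn (w := fun t => σ * B t ω) ha hab (hXc ω)
    (hUc ω) ((hBc ω).const_mul σ).continuousOn ?_ hXω hUω
  refine (hω.const_mul (σ ^ 4)).congr (ae_of_all _ fun t => ?_)
  ring
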